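/- Pick's theorem (convex case): Let S be a finite set of points of the integer lattice ℤ² in the plane, and let K be the convex hull (over ℝ) of S, regarded as a subset of ℝ². Assume K has nonempty interior (i.e., the points of S are not all collinear). Let b(K) denote the number of integer lattice points lying on the topological frontier of K, and let i(K) denote the number of integer lattice points lying in the topological interior of K. Then the two-dimensional Lebesgue measure of K equals b(K)/2 + i(K) − 1. -/

import Mathlib

open MeasureTheory

/-- A point of `ℝ × ℝ` is an integer lattice point if both coordinates are integers. -/
def IsLatticePoint (p : ℝ × ℝ) : Prop := ∃ a b : ℤ, p = ((a : ℝ), (b : ℝ))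

/-- The embedding of `ℤ × ℤ` into `ℝ × ℝ`. -/
def latticeEmbed (p : ℤ × ℤ) : ℝ × ℝ := ((p.1 : ℝ), (p.2 : ℝ))


noncomputable def pickW (y : ℝ) : ℝ := ((⌊y⌋ : ℝ) + (⌈y⌉ : ℝ)) / 2

lemma pickW_int (N : ℤ) : pickW (N : ℝ) = N := by
  simp [pickW]

lemma pickW_neg (y : ℝ) : pickW (-y) = - pickW y := by
  simp only [pickW, Int.floor_neg, Int.ceil_neg]; push_cast; ring

lemma pickW_sub (N : ℤ) (y : ℝ) : pickW (N - y) = N - pickW y := by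
  simp only [pickW, sub_eq_add_neg, Int.floor_intCast_add, Int.ceil_intCast_add,
    Int.floor_neg, Int.ceil_neg]; push_cast; ring

lemma pick_affine (g : ℝ → ℝ) (u v N M : ℤ) (huv : u < v)
    (hg : ∀ x ∈ Set.Icc (u : ℝ) v, g x = N + ((M : ℝ) - N) / ((v : ℝ) - u) * (x - u)) :
    IntervalIntegrable g volume u v ∧
      ∫ x in (u : ℝ)..v, g x =
        ∑ n ∈ Finset.Ico u v, (pickW (g n) + pickW (g ((n + 1 : ℤ) : ℝ))) / 2 := by
  have huv' : (u : ℝ) < v := by exact_mod_cast huv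
  have hne : (v : ℝ) - u ≠ 0 := by linarith
  have hE : Set.EqOn (fun x : ℝ => N + ((M : ℝ) - N) / ((v : ℝ) - u) * (x - u)) g
      (Set.uIcc (u : ℝ) v) := by
    intro x hx
    rw [Set.uIcc_of_le huv'.le] at hx
    exact (hg x hx).symm
  have hc : Continuous (fun x : ℝ => N + ((M : ℝ) - N) / ((v : ℝ) - u) * (x - u)) := by fun_prop
  refine ⟨(hc.intervalIntegrable _ _).congr (fun x hx => hE (Set.uIoc_subset_uIcc hx)), ?_⟩
  rw [← intervalIntegral.integral_congr hE]
  have h1 : ∫ x in (u : ℝ)..v, (N + ((M : ℝ) - N) / ((v : ℝ) - u) * (x - u))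
      = ((v : ℝ) - u) * (N + M) / 2 := by
    rw [intervalIntegral.integral_add (by simp) ((by fun_prop : Continuous _).intervalIntegrable _ _),
      intervalIntegral.integral_const_mul, intervalIntegral.integral_sub (by simp) (by simp)]
    simp
    field_simp
    ring
  rw [h1]
  set T : ℤ → ℝ := fun n => (pickW (g n) + pickW (g ((n + 1 : ℤ) : ℝ))) / 2 with hT
  have hsym : ∀ n : ℤ, u ≤ n → n ≤ v →
      pickW (g ((u + v - n : ℤ) : ℝ)) = (N + M : ℤ) - pickW (g n) := by
    intro n h1 h2
    have h1' : (u : ℝ) ≤ n := by exact_mod_cast h1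
    have h2' : (n : ℝ) ≤ v := by exact_mod_cast h2
    rw [← pickW_sub, hg n ⟨h1', h2'⟩, hg _ ⟨by push_cast; linarith, by push_cast; linarith⟩]
    congr 1
    push_cast
    field_simp
    ring
  have hrefl : ∑ n ∈ Finset.Ico u v, T n = ∑ n ∈ Finset.Ico u v, T (u + v - 1 - n) := by
    apply Finset.sum_nbij' (fun n => u + v - 1 - n) (fun n => u + v - 1 - n)
    · intro n hn; simp only [Finset.mem_Ico] at *; omega
    · intro n hn; simp only [Finset.mem_Ico] at *; omega
    · intro n hn; ring
    · intro n hn; ring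
    · intro n hn; congr 1; ring
  have hsum : ∑ n ∈ Finset.Ico u v, (T n + T (u + v - 1 - n)) = ((v : ℝ) - u) * (N + M) := by
    rw [Finset.sum_congr rfl (g := fun _ => ((N : ℝ) + M))]
    · rw [Finset.sum_const, Int.card_Ico, nsmul_eq_mul]
      congr 1
      have : (((v - u).toNat : ℤ) : ℝ) = ((v - u : ℤ) : ℝ) := by
        rw [Int.toNat_of_nonneg (by omega)]
      rw [Int.cast_natCast] at this
      rw [this]; push_cast; ring
    · intro n hn
      simp only [Finset.mem_Ico] at hn
      have e1 := hsym n (by omega) (by omega)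
      have e2 := hsym (n + 1) (by omega) (by omega)
      simp only [hT]
      rw [show u + v - 1 - n + 1 = u + v - n by ring, show u + v - 1 - n = u + v - (n + 1) by ring,
        e1, e2]
      push_cast
      ring
  rw [Finset.sum_add_distrib, ← hrefl] at hsum
  linarith

lemma pick_conc {g : ℝ → ℝ} {s : Set ℝ} (h : ConcaveOn ℝ s g) {x y z : ℝ} (hx : x ∈ s)
    (hz : z ∈ s) (hxy : x ≤ y) (hyz : y ≤ z) (hxz : x < z) :
    (z - y) * g x + (y - x) * g z ≤ (z - x) * g y := by
  have hd : z - x ≠ 0 := by linarith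
  have h0 : (0 : ℝ) < z - x := by linarith
  have h1 : (0 : ℝ) ≤ (z - y) / (z - x) := div_nonneg (by linarith) h0.le
  have h2 : (0 : ℝ) ≤ (y - x) / (z - x) := div_nonneg (by linarith) h0.le
  have h3 : (z - y) / (z - x) + (y - x) / (z - x) = 1 := by field_simp; ring
  have := h.2 hx hz h1 h2 h3
  have e : ((z - y) / (z - x)) • x + ((y - x) / (z - x)) • z = y := by
    simp only [smul_eq_mul]; field_simp; ring
  rw [e] at this
  simp only [smul_eq_mul] at this
  rw [div_mul_eq_mul_div, div_mul_eq_mul_div, ← add_div, div_le_iff₀ h0] at this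
  linarith

lemma pick_side (S : Finset (ℤ × ℤ)) (hne : S.Nonempty) (g : ℝ → ℝ) (a b : ℤ)
    (hconc : ConcaveOn ℝ (Set.Icc (a : ℝ) b) g)
    (hS : ∀ s ∈ S, a ≤ s.1 ∧ s.1 ≤ b ∧ (s.2 : ℝ) ≤ g s.1)
    (hb : ∀ m k : ℝ, (∀ s ∈ S, (s.2 : ℝ) ≤ m * s.1 + k) →
      ∀ x ∈ Set.Icc (a : ℝ) b, g x ≤ m * x + k) :
    ∀ n : ℕ, ∀ u v : ℤ, (v - u).toNat = n → a ≤ u → v ≤ b → u < v →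
      (∃ N : ℤ, g u = N) → (∃ N : ℤ, g v = N) →
      IntervalIntegrable g volume u v ∧
      ∫ x in (u : ℝ)..v, g x =
        ∑ n ∈ Finset.Ico u v, (pickW (g n) + pickW (g ((n + 1 : ℤ) : ℝ))) / 2 := by
  intro n
  induction n using Nat.strong_induction_on with
  | _ n ih =>
  rintro u v hn hau hvb huv ⟨N, hN⟩ ⟨M, hM⟩
  have huv' : (u : ℝ) < v := by exact_mod_cast huv
  have hau' : (a : ℝ) ≤ u := by exact_mod_cast hau
  have hvb' : (v : ℝ) ≤ b := by exact_mod_cast hvb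
  set m : ℝ := ((M : ℝ) - N) / ((v : ℝ) - u) with hm
  have hmv : m * (v - u) = M - N := by
    rw [hm]; field_simp [show (v : ℝ) - u ≠ 0 by linarith]
  have hu : (u : ℝ) ∈ Set.Icc (a : ℝ) b := ⟨hau', by linarith⟩
  have hv : (v : ℝ) ∈ Set.Icc (a : ℝ) b := ⟨by linarith, hvb'⟩
  have hM' : (M : ℝ) = N + m * (v - u) := by linarith
  have hout : ∀ x ∈ Set.Icc (a : ℝ) b, (x ≤ u ∨ v ≤ x) → g x ≤ N + m * (x - u) := by
    rintro x hx (h | h)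
    · have := pick_conc hconc hx hv h huv'.le (by linarith)
      rw [hN, hM, hM'] at this
      have : (v - u : ℝ) * g x ≤ (v - u : ℝ) * (N + m * (x - u)) := by linarith
      exact le_of_mul_le_mul_left this (by linarith)
    · have := pick_conc hconc hu hx huv'.le h (by linarith)
      rw [hN, hM, hM'] at this
      have : (v - u : ℝ) * g x ≤ (v - u : ℝ) * (N + m * (x - u)) := by linarith
      exact le_of_mul_le_mul_left this (by linarith)
  obtain ⟨s, hs, hmax⟩ := S.exists_max_image (fun s => (s.2 : ℝ) - m * s.1) hne
  obtain ⟨hs1, hs2, hs3⟩ := hS s hs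
  have hs1' : (a : ℝ) ≤ s.1 := by exact_mod_cast hs1
  have hs2' : (s.1 : ℝ) ≤ b := by exact_mod_cast hs2
  by_cases hcase : (s.2 : ℝ) - m * s.1 ≤ N - m * u
  · apply pick_affine g u v N M huv
    intro x hx
    have hx' : x ∈ Set.Icc (a : ℝ) b := ⟨by linarith [hx.1], by linarith [hx.2]⟩
    apply le_antisymm
    · have := hb m (N - m * u) (fun t ht => by linarith [hmax t ht]) x hx'
      rw [← hm]; linarith
    · have := pick_conc hconc hu hv hx.1 hx.2 huv'
      rw [hN, hM, hM'] at this
      rw [← hm]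
      have : (v - u : ℝ) * (N + m * (x - u)) ≤ (v - u : ℝ) * g x := by linarith
      exact le_of_mul_le_mul_left this (by linarith)
  · push Not at hcase
    have hgs : g s.1 = (s.2 : ℤ) := by
      apply le_antisymm _ hs3
      have := hb m (s.2 - m * s.1) (fun t ht => by linarith [hmax t ht]) s.1 ⟨hs1', hs2'⟩
      linarith
    have hus : u < s.1 := by
      by_contra hh
      push Not at hh
      have := hout s.1 ⟨hs1', hs2'⟩ (Or.inl (by exact_mod_cast hh))
      linarith
    have hsv : s.1 < v := by
      by_contra hh
      push Not at hh
      have := hout s.1 ⟨hs1', hs2'⟩ (Or.inr (by exact_mod_cast hh))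
      linarith
    obtain ⟨i1, e1⟩ := ih _ (by omega) u s.1 rfl hau (by omega) hus ⟨N, hN⟩ ⟨_, hgs⟩
    obtain ⟨i2, e2⟩ := ih _ (by omega) s.1 v rfl (by omega) hvb hsv ⟨_, hgs⟩ ⟨M, hM⟩
    refine ⟨i1.trans i2, ?_⟩
    rw [← intervalIntegral.integral_add_adjacent_intervals i1 i2, e1, e2,
      ← Finset.sum_union (Finset.Ico_disjoint_Ico_consecutive _ _ _),
      Finset.Ico_union_Ico_eq_Ico hus.le hsv.le]

/-- value at an extreme column is an integer -/
lemma pick_end (S : Finset (ℤ × ℤ)) (g : ℝ → ℝ) (a b c : ℤ) (σ : ℝ)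
    (hS : ∀ s ∈ S, (s.2 : ℝ) ≤ g s.1)
    (hb : ∀ m k : ℝ, (∀ s ∈ S, (s.2 : ℝ) ≤ m * s.1 + k) →
      ∀ x ∈ Set.Icc (a : ℝ) b, g x ≤ m * x + k)
    (hc : (c : ℝ) ∈ Set.Icc (a : ℝ) b)
    (hσ : ∀ s ∈ S, s.1 ≠ c → 1 ≤ σ * ((s.1 : ℝ) - c)) (hex : ∃ s ∈ S, s.1 = c) :
    ∃ N : ℤ, g c = N := by
  obtain ⟨s0, hs0, hs0c⟩ := hex
  obtain ⟨s, hs, hmax⟩ := (S.filter (fun s => s.1 = c)).exists_max_image (fun s => s.2)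
    ⟨s0, by simp [hs0, hs0c]⟩
  simp only [Finset.mem_filter] at hs hmax
  obtain ⟨t, ht, htmax⟩ := S.exists_max_image (fun s => s.2) ⟨s0, hs0⟩
  have hts : s.2 ≤ t.2 := htmax s hs.1
  have hts' : (s.2 : ℝ) ≤ t.2 := by exact_mod_cast hts
  refine ⟨s.2, le_antisymm ?_ (by have := hS s hs.1; rwa [hs.2] at this)⟩
  have := hb (σ * (t.2 - s.2)) (s.2 - σ * (t.2 - s.2) * c) (fun r hr => ?_) c hc
  · linarith
  · by_cases h : r.1 = c
    · have h2 : (r.2 : ℝ) ≤ s.2 := by exact_mod_cast hmax r ⟨hr, h⟩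
      rw [h]; linarith
    · have h1 := hσ r hr h
      have h2 : (r.2 : ℝ) ≤ t.2 := by exact_mod_cast htmax r hr
      nlinarith

lemma pick_halfplane (S : Finset (ℤ × ℤ)) (α β k : ℝ)
    (h : ∀ s ∈ S, α * (s.1 : ℝ) + β * (s.2 : ℝ) ≤ k) (x y : ℝ)
    (hp : (x, y) ∈ convexHull ℝ (↑(S.image latticeEmbed) : Set (ℝ × ℝ))) :
    α * x + β * y ≤ k := by
  have hc : Convex ℝ {p : ℝ × ℝ | α * p.1 + β * p.2 ≤ k} := by
    apply convex_halfSpace_le (f := fun p : ℝ × ℝ => α * p.1 + β * p.2)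
    constructor
    · intro p q; simp; ring
    · intro c p; simp; ring
  have hsub : (↑(S.image latticeEmbed) : Set (ℝ × ℝ)) ⊆ {p : ℝ × ℝ | α * p.1 + β * p.2 ≤ k} := by
    intro p hp
    simp only [Finset.coe_image, Set.mem_image, Finset.mem_coe] at hp
    obtain ⟨s, hs, rfl⟩ := hp
    exact h s hs
  exact convexHull_min hsub hc hp

lemma pick_hull (S : Finset (ℤ × ℤ)) (hne : S.Nonempty)
    (K : Set (ℝ × ℝ)) (hK : K = convexHull ℝ (↑(S.image latticeEmbed) : Set (ℝ × ℝ))) :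
    ∃ (a b : ℤ) (f g : ℝ → ℝ), (∃ s ∈ S, s.1 = a) ∧ (∃ s ∈ S, s.1 = b) ∧
      (∀ s ∈ S, a ≤ s.1 ∧ s.1 ≤ b) ∧
      (∀ x y, (x, y) ∈ K ↔ x ∈ Set.Icc (a : ℝ) b ∧ f x ≤ y ∧ y ≤ g x) ∧
      (∀ x ∈ Set.Icc (a : ℝ) b, f x ≤ g x) := by
  obtain ⟨s, hs, hmin⟩ := S.exists_min_image (fun s => s.1) hne
  obtain ⟨t, ht, hmax⟩ := S.exists_max_image (fun s => s.1) hne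
  have hconv : Convex ℝ K := hK ▸ convex_convexHull ℝ _
  have hcomp : IsCompact K := hK ▸ (Finset.finite_toSet _).isCompact_convexHull ℝ
  have hmem : ∀ s ∈ S, latticeEmbed s ∈ K := by
    intro s hs
    rw [hK]
    apply subset_convexHull
    simp only [Finset.coe_image]
    exact ⟨s, hs, rfl⟩
  have hx : ∀ x y, (x, y) ∈ K → x ∈ Set.Icc (s.1 : ℝ) t.1 := by
    intro x y hxy
    rw [hK] at hxy
    constructor
    · have := pick_halfplane S (-1) 0 (-s.1) (fun r hr => by
        have : (s.1 : ℝ) ≤ r.1 := by exact_mod_cast hmin r hr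
        linarith) x y hxy
      linarith
    · have := pick_halfplane S 1 0 t.1 (fun r hr => by
        have : (r.1 : ℝ) ≤ t.1 := by exact_mod_cast hmax r hr
        linarith) x y hxy
      linarith
  have hslice_ne : ∀ x ∈ Set.Icc (s.1 : ℝ) t.1, {y | (x, y) ∈ K}.Nonempty := by
    intro x hx
    have hc : Convex ℝ (Prod.fst '' K) := hconv.linear_image (LinearMap.fst ℝ ℝ ℝ)
    have := hc.ordConnected.out ⟨_, hmem s hs, rfl⟩ ⟨_, hmem t ht, rfl⟩ hx
    obtain ⟨⟨x', y⟩, hp, rfl⟩ := this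
    exact ⟨y, hp⟩
  have hslice_c : ∀ x, IsCompact {y | (x, y) ∈ K} := by
    intro x
    have h1 : {y | (x, y) ∈ K} = Prod.snd '' (K ∩ Prod.fst ⁻¹' {x}) := by
      ext y
      constructor
      · intro h; exact ⟨(x, y), ⟨h, rfl⟩, rfl⟩
      · rintro ⟨⟨x', y'⟩, ⟨h, h'⟩, rfl⟩
        simp only [Set.mem_preimage, Set.mem_singleton_iff] at h'
        subst h'; exact h
    rw [h1]
    exact (hcomp.inter_right (isClosed_singleton.preimage continuous_fst)).image continuous_snd
  have hslice_conv : ∀ x, Convex ℝ {y | (x, y) ∈ K} := by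
    intro x y hy z hz α β hα hβ hαβ
    have := hconv hy hz hα hβ hαβ
    have e : α • (x, y) + β • (x, z) = (x, α • y + β • z) := by
      ext
      · simp [← add_mul, hαβ]
      · simp
    rw [e] at this
    exact this
  refine ⟨s.1, t.1, fun x => sInf {y | (x, y) ∈ K}, fun x => sSup {y | (x, y) ∈ K},
    ⟨s, hs, rfl⟩, ⟨t, ht, rfl⟩, fun r hr => ⟨hmin r hr, hmax r hr⟩, ?_, ?_⟩
  · intro x y
    constructor
    · intro h
      exact ⟨hx x y h, csInf_le (hslice_c x).bddBelow h, le_csSup (hslice_c x).bddAbove h⟩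
    · rintro ⟨h1, h2, h3⟩
      exact (hslice_conv x).ordConnected.out ((hslice_c x).sInf_mem (hslice_ne x h1))
        ((hslice_c x).sSup_mem (hslice_ne x h1)) ⟨h2, h3⟩
  · intro x h
    exact csInf_le (hslice_c x).bddBelow ((hslice_c x).sSup_mem (hslice_ne x h))

lemma pick_concave (K : Set (ℝ × ℝ)) (hconv : Convex ℝ K) (a b : ℝ) (f g : ℝ → ℝ)
    (hKfg : ∀ x y, (x, y) ∈ K ↔ x ∈ Set.Icc a b ∧ f x ≤ y ∧ y ≤ g x)
    (hfg : ∀ x ∈ Set.Icc a b, f x ≤ g x) :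
    ConcaveOn ℝ (Set.Icc a b) g ∧ ConvexOn ℝ (Set.Icc a b) f := by
  refine ⟨⟨convex_Icc _ _, ?_⟩, ⟨convex_Icc _ _, ?_⟩⟩
  · intro x hx z hz α β hα hβ hαβ
    exact ((hKfg _ _).1 (hconv ((hKfg x (g x)).2 ⟨hx, hfg x hx, le_rfl⟩)
      ((hKfg z (g z)).2 ⟨hz, hfg z hz, le_rfl⟩) hα hβ hαβ)).2.2
  · intro x hx z hz α β hα hβ hαβ
    exact ((hKfg _ _).1 (hconv ((hKfg x (f x)).2 ⟨hx, le_rfl, hfg x hx⟩)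
      ((hKfg z (f z)).2 ⟨hz, le_rfl, hfg z hz⟩) hα hβ hαβ)).2.1

/-- points near an interior point -/
lemma pick_near (K : Set (ℝ × ℝ)) (x y : ℝ) (h : (x, y) ∈ interior K) :
    ∃ ε > 0, (x + ε, y) ∈ K ∧ (x - ε, y) ∈ K ∧ (x, y + ε) ∈ K ∧ (x, y - ε) ∈ K := by
  rw [mem_interior_iff_mem_nhds, Metric.mem_nhds_iff] at h
  obtain ⟨ε, hε, hb⟩ := h
  have : |ε| / 2 < ε := by rw [abs_of_pos hε]; linarith
  refine ⟨ε / 2, by linarith, hb ?_, hb ?_, hb ?_, hb ?_⟩ <;>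
  simp [Prod.dist_eq, hε, this]

lemma pick_interior (K : Set (ℝ × ℝ)) (hconv : Convex ℝ K) (a b : ℝ) (f g : ℝ → ℝ)
    (hKfg : ∀ x y, (x, y) ∈ K ↔ x ∈ Set.Icc a b ∧ f x ≤ y ∧ y ≤ g x)
    (hfg : ∀ x ∈ Set.Icc a b, f x ≤ g x) (hint : (interior K).Nonempty) :
    a < b ∧ interior K = regionBetween f g (Set.Ioo a b) ∧ ∀ x ∈ Set.Ioo a b, f x < g x := by
  obtain ⟨hg, hf⟩ := pick_concave K hconv a b f g hKfg hfg
  have hsub : interior K ⊆ regionBetween f g (Set.Ioo a b) := by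
    rintro ⟨x, y⟩ hp
    obtain ⟨ε, hε, h1, h2, h3, h4⟩ := pick_near K x y hp
    rw [hKfg] at h1 h2 h3 h4
    refine ⟨⟨?_, ?_⟩, ?_, ?_⟩
    · linarith [h2.1.1]
    · linarith [h1.1.2]
    · show f x < y
      linarith [h4.2.1]
    · show y < g x
      linarith [h3.2.2]
  obtain ⟨⟨x0, y0⟩, hp0⟩ := hint
  obtain ⟨hx0, hy0⟩ := hsub hp0
  have hx0' : x0 ∈ Set.Ioo a b := hx0
  have hy0' : 0 < g x0 - f x0 := by linarith [hy0.1.trans hy0.2]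
  have hab : a < b := hx0'.1.trans hx0'.2
  have hh : ConcaveOn ℝ (Set.Icc a b) (g - f) := hg.sub hf
  have hx0I : x0 ∈ Set.Icc a b := Set.Ioo_subset_Icc_self hx0'
  refine ⟨hab, Set.Subset.antisymm hsub ?_, ?_⟩
  · apply interior_maximal
    · rintro ⟨x, y⟩ ⟨h1, h2⟩
      exact (hKfg x y).2 ⟨Set.Ioo_subset_Icc_self h1, h2.1.le, h2.2.le⟩
    · have hgc : ContinuousOn g (Set.Ioo a b) :=
        (hg.subset Set.Ioo_subset_Icc_self (convex_Ioo _ _)).continuousOn isOpen_Ioo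
      have hfc : ContinuousOn f (Set.Ioo a b) :=
        (hf.subset Set.Ioo_subset_Icc_self (convex_Ioo _ _)).continuousOn isOpen_Ioo
      rw [isOpen_iff_mem_nhds]
      rintro ⟨x, y⟩ ⟨h1, h2⟩
      have h1' : x ∈ Set.Ioo a b := h1
      have hn : Set.Ioo a b ∈ nhds x := isOpen_Ioo.mem_nhds h1'
      have cg : ContinuousAt (fun p : ℝ × ℝ => g p.1) (x, y) :=
        ContinuousAt.comp (f := Prod.fst) (g := g) (hgc.continuousAt hn) continuousAt_fst
      have cf : ContinuousAt (fun p : ℝ × ℝ => f p.1) (x, y) :=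
        ContinuousAt.comp (f := Prod.fst) (g := f) (hfc.continuousAt hn) continuousAt_fst
      filter_upwards [cf.eventually_lt (continuousAt_snd) h2.1,
        (continuousAt_snd).eventually_lt cg h2.2,
        continuousAt_fst.preimage_mem_nhds hn] with p e1 e2 e3
      exact ⟨e3, e1, e2⟩
  · intro x hx
    have hxI : x ∈ Set.Icc a b := Set.Ioo_subset_Icc_self hx
    have haI : a ∈ Set.Icc a b := ⟨le_rfl, hab.le⟩
    have hbI : b ∈ Set.Icc a b := ⟨hab.le, le_rfl⟩
    have key : 0 < (g - f) x := by
      rcases le_total x x0 with h | h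
      · have := pick_conc hh haI hx0I hx.1.le h hx0'.1
        have h1 : 0 ≤ (g - f) a := sub_nonneg.2 (hfg a haI)
        have h2 : 0 < (x - a) * (g - f) x0 := mul_pos (by linarith [hx.1]) hy0'
        have h3 : 0 ≤ (x0 - x) * (g - f) a := mul_nonneg (by linarith) h1
        exact pos_of_mul_pos_right (lt_of_lt_of_le (by linarith) this) (by linarith [hx0'.1])
      · have := pick_conc hh hx0I hbI h hx.2.le hx0'.2
        have h1 : 0 ≤ (g - f) b := sub_nonneg.2 (hfg b hbI)
        have h2 : 0 < (b - x) * (g - f) x0 := mul_pos (by linarith [hx.2]) hy0'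
        have h3 : 0 ≤ (x - x0) * (g - f) b := mul_nonneg (by linarith) h1
        exact pos_of_mul_pos_right (lt_of_lt_of_le (by linarith) this) (by linarith [hx0'.2])
    exact sub_pos.1 key

lemma pick_ncard (T : Set (ℝ × ℝ)) (I : Finset ℤ) (J : ℤ → Finset ℤ)
    (h : ∀ n m : ℤ, ((n : ℝ), (m : ℝ)) ∈ T ↔ n ∈ I ∧ m ∈ J n) :
    {p : ℝ × ℝ | IsLatticePoint p ∧ p ∈ T}.Finite ∧
    {p : ℝ × ℝ | IsLatticePoint p ∧ p ∈ T}.ncard = ∑ n ∈ I, (J n).card := by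
  have e : {p : ℝ × ℝ | IsLatticePoint p ∧ p ∈ T} =
      (fun q : (Σ _ : ℤ, ℤ) => ((q.1 : ℝ), (q.2 : ℝ))) '' (I.sigma J : Set (Σ _ : ℤ, ℤ)) := by
    ext p
    constructor
    · rintro ⟨⟨n, m, rfl⟩, hT⟩
      refine ⟨⟨n, m⟩, ?_, rfl⟩
      have := (h n m).1 hT
      simpa using this
    · rintro ⟨⟨n, m⟩, hq, rfl⟩
      refine ⟨⟨n, m, rfl⟩, (h n m).2 (by simpa using hq)⟩
  rw [e]
  refine ⟨(Finset.finite_toSet _).image _, ?_⟩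
  rw [Set.ncard_image_of_injective, Set.ncard_coe_finset, Finset.card_sigma]
  rintro ⟨n, m⟩ ⟨n', m'⟩ hq
  simp only [Prod.mk.injEq, Int.cast_inj] at hq
  obtain ⟨rfl, rfl⟩ := hq
  rfl

lemma pick_trap (D : ℤ → ℝ) (a b : ℤ) (hab : a < b) :
    ∑ n ∈ Finset.Ico a b, (D n + D (n + 1)) / 2 =
      ∑ n ∈ Finset.Ioo a b, D n + (D a + D b) / 2 := by
  have h1 : ∑ n ∈ Finset.Ico a b, D n = D a + ∑ n ∈ Finset.Ioo a b, D n := by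
    rw [← Finset.Ioo_insert_left hab, Finset.sum_insert (by simp)]
  have h2 : ∑ n ∈ Finset.Ico a b, D (n + 1) = D b + ∑ n ∈ Finset.Ioo a b, D n := by
    have : ∑ n ∈ Finset.Ico a b, D (n + 1) = ∑ n ∈ Finset.Ioc a b, D n := by
      apply Finset.sum_nbij' (fun n => n + 1) (fun n => n - 1)
      · intro n hn; simp only [Finset.mem_Ico, Finset.mem_Ioc] at *; omega
      · intro n hn; simp only [Finset.mem_Ico, Finset.mem_Ioc] at *; omega
      · intro n hn; ring
      · intro n hn; ring
      · intro n hn; rfl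
    rw [this, ← Finset.Ioo_insert_right hab, Finset.sum_insert (by simp)]
  rw [← Finset.sum_div, Finset.sum_add_distrib, h1, h2]
  ring

lemma pick_sum_Icc (D : ℤ → ℝ) (a b : ℤ) (hab : a < b) :
    ∑ n ∈ Finset.Icc a b, D n = ∑ n ∈ Finset.Ioo a b, D n + D a + D b := by
  rw [← Finset.Ico_insert_right hab.le, Finset.sum_insert (by simp),
    ← Finset.Ioo_insert_left hab, Finset.sum_insert (by simp)]
  ring

/-- **Pick's theorem (convex case).** -/
theorem pick_theorem_convex (S : Finset (ℤ × ℤ))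
    (K : Set (ℝ × ℝ)) (hK : K = convexHull ℝ (↑(S.image latticeEmbed) : Set (ℝ × ℝ)))
    (hint : (interior K).Nonempty) :
    (volume K).toReal =
      ({p : ℝ × ℝ | IsLatticePoint p ∧ p ∈ frontier K}.ncard : ℝ) / 2 +
      ({p : ℝ × ℝ | IsLatticePoint p ∧ p ∈ interior K}.ncard : ℝ) - 1 := by
  have hne : S.Nonempty := by
    rw [Finset.nonempty_iff_ne_empty]
    rintro rfl
    obtain ⟨p, hp⟩ := hint
    have := interior_subset hp
    rw [hK] at this
    simp at this
  have hconv : Convex ℝ K := hK ▸ convex_convexHull ℝ _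
  have hcomp : IsCompact K := hK ▸ (Finset.finite_toSet _).isCompact_convexHull ℝ
  obtain ⟨a, b, f, g, ha, hb, hS, hKfg, hfg⟩ := pick_hull S hne K hK
  obtain ⟨hab', hintK, hlt⟩ := pick_interior K hconv a b f g hKfg hfg hint
  obtain ⟨hg, hf⟩ := pick_concave K hconv a b f g hKfg hfg
  have hab : a < b := by exact_mod_cast hab'
  have hmem : ∀ s ∈ S, ((s.1 : ℝ), (s.2 : ℝ)) ∈ K := by
    intro s hs
    rw [hK]
    apply subset_convexHull
    simp only [Finset.coe_image]
    exact ⟨s, hs, rfl⟩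
  have haI : (a : ℝ) ∈ Set.Icc (a : ℝ) b := ⟨le_rfl, hab'.le⟩
  have hbI : (b : ℝ) ∈ Set.Icc (a : ℝ) b := ⟨hab'.le, le_rfl⟩
  have hgS : ∀ s ∈ S, (s.2 : ℝ) ≤ g s.1 := fun s hs => ((hKfg _ _).1 (hmem s hs)).2.2
  have hgb : ∀ m k : ℝ, (∀ s ∈ S, (s.2 : ℝ) ≤ m * s.1 + k) →
      ∀ x ∈ Set.Icc (a : ℝ) b, g x ≤ m * x + k := by
    intro m k h x hx
    have h1 : (x, g x) ∈ K := (hKfg _ _).2 ⟨hx, hfg x hx, le_rfl⟩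
    rw [hK] at h1
    have := pick_halfplane S (-m) 1 k (fun s hs => by linarith [h s hs]) x (g x) h1
    linarith
  set S' : Finset (ℤ × ℤ) := S.image (fun s => (s.1, -s.2)) with hS'
  have hfS : ∀ s ∈ S', (s.2 : ℝ) ≤ (-f) s.1 := by
    intro s hs
    simp only [hS', Finset.mem_image] at hs
    obtain ⟨t, ht, rfl⟩ := hs
    have := ((hKfg _ _).1 (hmem t ht)).2.1
    simp only [Pi.neg_apply, Int.cast_neg]
    linarith
  have hfb : ∀ m k : ℝ, (∀ s ∈ S', (s.2 : ℝ) ≤ m * s.1 + k) →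
      ∀ x ∈ Set.Icc (a : ℝ) b, (-f) x ≤ m * x + k := by
    intro m k h x hx
    have h1 : (x, f x) ∈ K := (hKfg _ _).2 ⟨hx, le_rfl, hfg x hx⟩
    rw [hK] at h1
    have := pick_halfplane S (-m) (-1) k (fun s hs => by
      have := h (s.1, -s.2) (Finset.mem_image_of_mem _ hs)
      push_cast at this
      linarith) x (f x) h1
    simp only [Pi.neg_apply]
    linarith
  have hS2 : ∀ s ∈ S', a ≤ s.1 ∧ s.1 ≤ b := by
    intro s hs
    simp only [hS', Finset.mem_image] at hs
    obtain ⟨t, ht, rfl⟩ := hs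
    exact hS t ht
  have ha' : ∃ s ∈ S', s.1 = a := by
    obtain ⟨s, hs, h⟩ := ha
    exact ⟨_, Finset.mem_image_of_mem _ hs, h⟩
  have hb' : ∃ s ∈ S', s.1 = b := by
    obtain ⟨s, hs, h⟩ := hb
    exact ⟨_, Finset.mem_image_of_mem _ hs, h⟩
  have hσa : ∀ T : Finset (ℤ × ℤ), (∀ s ∈ T, a ≤ s.1 ∧ s.1 ≤ b) →
      ∀ s ∈ T, s.1 ≠ a → (1 : ℝ) ≤ 1 * ((s.1 : ℝ) - a) := by
    intro T hT s hs hsa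
    have h1 : a + 1 ≤ s.1 := by have := hT s hs; omega
    have : (a : ℝ) + 1 ≤ s.1 := by exact_mod_cast h1
    linarith
  have hσb : ∀ T : Finset (ℤ × ℤ), (∀ s ∈ T, a ≤ s.1 ∧ s.1 ≤ b) →
      ∀ s ∈ T, s.1 ≠ b → (1 : ℝ) ≤ (-1) * ((s.1 : ℝ) - b) := by
    intro T hT s hs hsa
    have h1 : s.1 + 1 ≤ b := by have := hT s hs; omega
    have : (s.1 : ℝ) + 1 ≤ b := by exact_mod_cast h1
    linarith
  obtain ⟨ga, hga⟩ := pick_end S g a b a 1 hgS hgb haI (hσa S hS) ha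
  obtain ⟨gb, hgb'⟩ := pick_end S g a b b (-1) hgS hgb hbI (hσb S hS) hb
  obtain ⟨fa, hfa⟩ := pick_end S' (-f) a b a 1 hfS hfb haI (hσa S' hS2) ha'
  obtain ⟨fb, hfb'⟩ := pick_end S' (-f) a b b (-1) hfS hfb hbI (hσb S' hS2) hb'
  obtain ⟨gi, gint⟩ := pick_side S hne g a b hg
    (fun s hs => ⟨(hS s hs).1, (hS s hs).2, hgS s hs⟩) hgb _ a b rfl le_rfl le_rfl hab
    ⟨ga, hga⟩ ⟨gb, hgb'⟩
  obtain ⟨fi', fint'⟩ := pick_side S' (hne.image _) (-f) a b hf.neg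
    (fun s hs => ⟨(hS2 s hs).1, (hS2 s hs).2, hfS s hs⟩) hfb _ a b rfl le_rfl le_rfl hab
    ⟨fa, hfa⟩ ⟨fb, hfb'⟩
  have fi : IntervalIntegrable f volume a b := by simpa using fi'.neg
  have hfa2 : f a = ((-fa : ℤ) : ℝ) := by push_cast; rw [← hfa]; simp
  have hfb2 : f b = ((-fb : ℤ) : ℝ) := by push_cast; rw [← hfb']; simp
  set D : ℤ → ℝ := fun n => pickW (g n) - pickW (f n) with hD
  have harea : (volume K).toReal = ∑ n ∈ Finset.Ioo a b, D n + (D a + D b) / 2 := by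
    have hv : volume K = volume (interior K) :=
      (measure_interior_of_null_frontier (hconv.addHaar_frontier volume)).symm
    have gi' : IntegrableOn g (Set.Ioo (a : ℝ) b) volume :=
      ((intervalIntegrable_iff_integrableOn_Ioc_of_le hab'.le).1 gi).mono_set
        Set.Ioo_subset_Ioc_self
    have fi'' : IntegrableOn f (Set.Ioo (a : ℝ) b) volume :=
      ((intervalIntegrable_iff_integrableOn_Ioc_of_le hab'.le).1 fi).mono_set
        Set.Ioo_subset_Ioc_self
    rw [hv, hintK, Measure.volume_eq_prod, volume_regionBetween_eq_integral fi'' gi'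
      measurableSet_Ioo (fun x hx => (hlt x hx).le), ENNReal.toReal_ofReal]
    · rw [← integral_Ioc_eq_integral_Ioo, ← intervalIntegral.integral_of_le hab'.le]
      simp only [Pi.sub_apply]
      rw [intervalIntegral.integral_sub gi fi, ← pick_trap D a b hab]
      have : ∫ x in (a : ℝ)..b, f x = - ∫ x in (a : ℝ)..b, (-f) x := by simp
      rw [this, fint', gint, sub_neg_eq_add, ← Finset.sum_add_distrib]
      apply Finset.sum_congr rfl
      intro n hn
      simp only [hD, Pi.neg_apply, pickW_neg]
      ring
    · apply setIntegral_nonneg measurableSet_Ioo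
      intro x hx
      exact sub_nonneg.2 (hlt x hx).le
  obtain ⟨hCfin, hC⟩ := pick_ncard K (Finset.Icc a b)
    (fun n => Finset.Icc ⌈f n⌉ ⌊g n⌋) (by
      intro n m
      rw [hKfg]
      simp only [Set.mem_Icc, Finset.mem_Icc, Int.ceil_le, Int.le_floor, Int.cast_le])
  obtain ⟨hIfin, hI⟩ := pick_ncard (interior K) (Finset.Ioo a b)
    (fun n => Finset.Ioo ⌊f n⌋ ⌈g n⌉) (by
      intro n m
      rw [hintK]
      simp only [regionBetween, Set.mem_setOf_eq, Set.mem_Ioo, Finset.mem_Ioo, Int.floor_lt,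
        Int.lt_ceil, Int.cast_lt])
  have hB : ({p : ℝ × ℝ | IsLatticePoint p ∧ p ∈ frontier K}.ncard : ℝ) =
      ({p : ℝ × ℝ | IsLatticePoint p ∧ p ∈ K}.ncard : ℝ) -
      ({p : ℝ × ℝ | IsLatticePoint p ∧ p ∈ interior K}.ncard : ℝ) := by
    have e : {p : ℝ × ℝ | IsLatticePoint p ∧ p ∈ frontier K} =
        {p : ℝ × ℝ | IsLatticePoint p ∧ p ∈ K} \ {p : ℝ × ℝ | IsLatticePoint p ∧ p ∈ interior K} := by
      ext p
      simp only [hcomp.isClosed.frontier_eq, Set.mem_diff, Set.mem_setOf_eq]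
      tauto
    have hsub : {p : ℝ × ℝ | IsLatticePoint p ∧ p ∈ interior K} ⊆
        {p : ℝ × ℝ | IsLatticePoint p ∧ p ∈ K} := fun p hp => ⟨hp.1, interior_subset hp.2⟩
    have := Set.ncard_diff_add_ncard_of_subset hsub hCfin
    rw [← e] at this
    rw [← this]; push_cast; ring
  have hcardZ : ∀ z : ℤ, 0 ≤ z → ((z.toNat : ℕ) : ℝ) = (z : ℝ) := by
    intro z hz
    rw [← Int.cast_natCast, Int.toNat_of_nonneg hz]
  have hcol : ∀ n ∈ Finset.Ioo a b, ((Finset.Icc ⌈f n⌉ ⌊g n⌋).card : ℝ) +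
      ((Finset.Ioo ⌊f n⌋ ⌈g n⌉).card : ℝ) = 2 * D n := by
    intro n hn
    rw [Finset.mem_Ioo] at hn
    have hl := hlt n ⟨by exact_mod_cast hn.1, by exact_mod_cast hn.2⟩
    have h1 : ⌊f n⌋ < ⌈g n⌉ := by
      have : (⌊f n⌋ : ℝ) < ⌈g n⌉ := lt_of_le_of_lt (Int.floor_le _) (hl.trans_le (Int.le_ceil _))
      exact_mod_cast this
    have h2 : ⌈f n⌉ ≤ ⌊g n⌋ + 1 := by
      rw [Int.ceil_le]
      push_cast
      linarith [Int.lt_floor_add_one (g n)]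
    rw [Int.card_Icc, Int.card_Ioo, hcardZ _ (by omega), hcardZ _ (by omega)]
    simp only [hD, pickW]
    push_cast
    ring
  have hend : ∀ c N M : ℤ, (c : ℝ) ∈ Set.Icc (a : ℝ) b → f c = N → g c = M →
      ((Finset.Icc ⌈f c⌉ ⌊g c⌋).card : ℝ) = D c + 1 := by
    intro c N M hc hN hM
    have hNM : N ≤ M := by
      have := hfg c hc
      rw [hN, hM] at this
      exact_mod_cast this
    simp only [hD]
    rw [hN, hM, pickW_int, pickW_int, Int.ceil_intCast, Int.floor_intCast, Int.card_Icc,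
      hcardZ _ (by omega)]
    push_cast
    ring
  have htot : ({p : ℝ × ℝ | IsLatticePoint p ∧ p ∈ K}.ncard : ℝ) +
      ({p : ℝ × ℝ | IsLatticePoint p ∧ p ∈ interior K}.ncard : ℝ) =
      ∑ n ∈ Finset.Ioo a b, 2 * D n + (D a + 1) + (D b + 1) := by
    rw [hC, hI]
    push_cast
    rw [pick_sum_Icc (fun n => ((Finset.Icc ⌈f n⌉ ⌊g n⌋).card : ℝ)) a b hab,
      hend a _ _ haI hfa2 hga, hend b _ _ hbI hfb2 hgb', ← Finset.sum_congr rfl hcol,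
      Finset.sum_add_distrib]
    ring
  rw [← Finset.mul_sum] at htot
  rw [harea, hB]
  linarith
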